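/- arXiv:1712.01465 — 3 statements merged into one kernel-verified Lean document; each statement's English description precedes it below -/
import Mathlib

section
/- Let G be a finite abelian group, k ≥ 1 an integer, and f : G → ℂ a function. Suppose that the number of characters χ : G → ℂˣ with ∑_{t ∈ G} f(t)·χ(t) ≠ 0 is at most k − 1. Then for every choice of elements t₁, …, t_k ∈ G and s₁, …, s_k ∈ G, the k×k complex matrix whose (i, j) entry is f(s_j · t_i) has determinant zero. -/
theorem sum_monoidHom_apply_eq_ite {G : Type*} [CommGroup G] [Finite G] [DecidableEq G]
    [Fintype (G →* ℂˣ)] (g : G) :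
    ∑ χ : G →* ℂˣ, (χ g : ℂ) = if g = 1 then (Fintype.card (G →* ℂˣ) : ℂ) else 0 := by
  split_ifs with hg
  · simp [hg]
  have : NeZero (Monoid.exponent G) := ⟨Monoid.exponent_ne_zero_of_finite⟩
  obtain ⟨φ, hφ⟩ := CommGroup.exists_apply_ne_one_of_hasEnoughRootsOfUnity G ℂ hg
  have hshift : (φ g : ℂ) * ∑ χ : G →* ℂˣ, (χ g : ℂ) = ∑ χ : G →* ℂˣ, (χ g : ℂ) := by
    rw [Finset.mul_sum]
    exact Fintype.sum_equiv (Equiv.mulLeft φ) _ _ fun χ => by simp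
  exact eq_zero_of_mul_eq_self_left (by simpa using hφ) hshift

theorem card_mul_eq_sum_monoidHom {G : Type*} [CommGroup G] [Fintype G] [Fintype (G →* ℂˣ)]
    (f : G → ℂ) (g : G) :
    (Fintype.card (G →* ℂˣ) : ℂ) * f g =
      ∑ χ : G →* ℂˣ, (∑ t : G, f t * (χ t : ℂ)) * (χ g⁻¹ : ℂ) := by
  classical
  have hterm (t : G) : ∑ χ : G →* ℂˣ, f t * (χ t : ℂ) * (χ g⁻¹ : ℂ) =
      if t = g then (Fintype.card (G →* ℂˣ) : ℂ) * f t else 0 := by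
    simp_rw [mul_assoc, ← Units.val_mul, ← map_mul]
    rw [← Finset.mul_sum, sum_monoidHom_apply_eq_ite]
    simp [mul_inv_eq_one, mul_comm]
  simp_rw [Finset.sum_mul]
  rw [Finset.sum_comm]
  simp only [hterm, Finset.sum_ite_eq', Finset.mem_univ, if_true]

theorem Matrix.det_mul_eq_zero_of_card_lt {K m n : Type*} [Field K] [Fintype m] [Fintype n]
    [DecidableEq n] (A : Matrix n m K) (B : Matrix m n K)
    (h : Fintype.card m < Fintype.card n) : (A * B).det = 0 := by
  by_contra hdet
  have hrank := Matrix.rank_of_isUnit (A * B)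
    ((Matrix.isUnit_iff_isUnit_det _).2 (isUnit_iff_ne_zero.2 hdet))
  have := (Matrix.rank_mul_le_left A B).trans A.rank_le_card_width
  omega

/-- Let `G` be a finite abelian group, `k ≥ 1`, and `f : G → ℂ`.  If the number of
characters `χ : G → ℂˣ` with `∑ t, f t * χ t ≠ 0` is at most `k - 1`, then for any
`t₁, …, t_k` and `s₁, …, s_k` in `G` the `k × k` matrix `(f (s_j * t_i))_{i,j}` has
determinant zero. -/
theorem det_eq_zero_of_few_nonvanishing_character_sums
    (G : Type) [CommGroup G] [Fintype G] (k : ℕ) (hk : 1 ≤ k) (f : G → ℂ)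
    (h : {χ : G →* ℂˣ | ∑ t : G, f t * (χ t : ℂ) ≠ 0}.ncard ≤ k - 1) :
    ∀ t s : Fin k → G,
      Matrix.det (Matrix.of fun i j : Fin k => f (s j * t i)) = 0 := by
  classical
  intro t s
  have : NeZero (Monoid.exponent G) := ⟨Monoid.exponent_ne_zero_of_finite⟩
  obtain ⟨e⟩ := CommGroup.monoidHom_mulEquiv_of_hasEnoughRootsOfUnity G ℂ
  have : Finite (G →* ℂˣ) := Finite.of_equiv G e.symm.toEquiv
  have := Fintype.ofFinite (G →* ℂˣ)
  let S : Finset (G →* ℂˣ) := {χ | ∑ t : G, f t * (χ t : ℂ) ≠ 0}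
  have hS : S.card < k := by
    have : {χ : G →* ℂˣ | ∑ t : G, f t * (χ t : ℂ) ≠ 0} = S := by ext; simp [S]
    rw [this, Set.ncard_coe_finset] at h
    omega
  let N : ℂ := Fintype.card (G →* ℂˣ)
  have hN : N ≠ 0 := Nat.cast_ne_zero.2 Fintype.card_ne_zero
  let A : Matrix (Fin k) S ℂ := Matrix.of fun i χ =>
    N⁻¹ * (∑ u : G, f u * (χ.1 u : ℂ)) * (χ.1 (t i)⁻¹ : ℂ)
  let B : Matrix S (Fin k) ℂ := Matrix.of fun χ j => (χ.1 (s j)⁻¹ : ℂ)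
  have hAB : (Matrix.of fun i j : Fin k => f (s j * t i)) = A * B := by
    ext i j
    rw [Matrix.mul_apply, Matrix.of_apply, ← inv_mul_cancel_left₀ hN (f (s j * t i)),
      card_mul_eq_sum_monoidHom,
      ← Finset.sum_subset S.subset_univ fun χ _ hχ => by
        rw [show ∑ u : G, f u * (χ u : ℂ) = 0 by simpa [S] using hχ, zero_mul],
      ← Finset.sum_coe_sort S, Finset.mul_sum]
    refine Finset.sum_congr rfl fun χ _ => ?_
    simp only [A, B, Matrix.of_apply, mul_inv, map_mul, Units.val_mul]
    ring
  rw [hAB]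
  exact Matrix.det_mul_eq_zero_of_card_lt A B (by simpa using hS)
end

section
/- Let G be a finite abelian group, V a finite-dimensional ℚ-vector space, ρ : G → GL(V) a ℚ-linear representation, and v ∈ V. Then the ℚ-dimension of the ℚ-linear span of the orbit {ρ(t)(v) : t ∈ G} is equal to the number of characters χ : G → ℂˣ such that ∑_{t ∈ G} χ(t) · (ρ(t)(v) ⊗ 1) ≠ 0 in the complexification V ⊗_ℚ ℂ. -/
open scoped TensorProduct

namespace Representation

variable {K G W : Type*} [Field K] [CommGroup G] [Fintype G] [AddCommGroup W] [Module K W]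

/-- The sum `∑ t, χ t • σ t w`, an unnormalised projection of `w` to the isotypic component
of `χ⁻¹`. -/
def charSum (σ : Representation K G W) (w : W) (χ : G →* Kˣ) : W :=
  ∑ t : G, (χ t : K) • σ t w

theorem apply_charSum (σ : Representation K G W) (w : W) (χ : G →* Kˣ) (s : G) :
    σ s (σ.charSum w χ) = ((χ s)⁻¹ : Kˣ) • σ.charSum w χ := by
  rw [eq_inv_smul_iff]
  simp only [charSum, map_sum, map_smul, Finset.smul_sum]
  refine Fintype.sum_equiv (Equiv.mulLeft s) _ _ fun t => ?_
  simp [Units.smul_def, smul_smul]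

theorem charSum_charSum_self (σ : Representation K G W) (w : W) (χ : G →* Kˣ) :
    σ.charSum (σ.charSum w χ) χ = (Fintype.card G : K) • σ.charSum w χ := by
  rw [charSum]
  simp [apply_charSum, Units.smul_def, smul_smul, Nat.cast_smul_eq_nsmul]

theorem charSum_charSum_of_ne (σ : Representation K G W) (w : W) {χ ψ : G →* Kˣ} (h : χ ≠ ψ) :
    σ.charSum (σ.charSum w χ) ψ = 0 := by
  have h0 : ∑ t : G, ((ψ t : K) * ((χ t)⁻¹ : Kˣ)) = 0 := by
    refine sum_hom_units_eq_zero ((Units.coeHom K).comp (ψ * χ⁻¹)) fun h1 => h ?_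
    ext t
    have h2 := DFunLike.congr_fun h1 t
    simp only [MonoidHom.comp_apply, Units.coeHom_apply, MonoidHom.one_apply,
      Units.val_eq_one, MonoidHom.mul_apply, MonoidHom.inv_apply, mul_inv_eq_one] at h2
    rw [h2]
  rw [charSum]
  simp only [apply_charSum, Units.smul_def, smul_smul]
  rw [← Finset.sum_smul, h0, zero_smul]

theorem charSum_sum_smul {ι : Type*} (σ : Representation K G W) (s : Finset ι) (c : ι → K)
    (w : ι → W) (χ : G →* Kˣ) :
    σ.charSum (∑ i ∈ s, c i • w i) χ = ∑ i ∈ s, c i • σ.charSum (w i) χ := by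
  simp only [charSum, map_sum, map_smul, Finset.smul_sum]
  rw [Finset.sum_comm]
  exact Finset.sum_congr rfl fun _ _ => Finset.sum_congr rfl fun _ _ => smul_comm _ _ _

theorem linearIndependent_charSum [NeZero (Fintype.card G : K)] (σ : Representation K G W)
    (w : W) :
    LinearIndependent K fun χ : {χ : G →* Kˣ | σ.charSum w χ ≠ 0} => σ.charSum w χ := by
  rw [linearIndependent_iff']
  intro s c hc ψ hψ
  have h := charSum_sum_smul σ s c (fun χ => σ.charSum w χ) ψ
  rw [hc, Finset.sum_eq_single_of_mem ψ hψ fun χ _ hχ => by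
    rw [charSum_charSum_of_ne _ _ (Subtype.coe_injective.ne hχ), smul_zero],
    charSum_charSum_self] at h
  have h0 : σ.charSum 0 (ψ : G →* Kˣ) = 0 := by simp [charSum]
  rw [h0, eq_comm, smul_eq_zero, smul_eq_zero] at h
  exact h.resolve_right (not_or.2 ⟨NeZero.ne _, ψ.2⟩)

variable [HasEnoughRootsOfUnity K (Monoid.exponent G)]

theorem sum_monoidHom_apply_eq_zero [Fintype (G →* Kˣ)] {a : G} (ha : a ≠ 1) :
    ∑ χ : G →* Kˣ, (χ a : K) = 0 := by
  refine sum_hom_units_eq_zero ((Units.coeHom K).comp (MonoidHom.eval a)) fun h => ?_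
  obtain ⟨φ, hφ⟩ := CommGroup.exists_apply_ne_one_of_hasEnoughRootsOfUnity G K ha
  exact hφ (by simpa using DFunLike.congr_fun h φ)

theorem sum_inv_smul_charSum [Fintype (G →* Kˣ)] (σ : Representation K G W) (w : W) (s : G) :
    ∑ χ : G →* Kˣ, (((χ s)⁻¹ : Kˣ) : K) • σ.charSum w χ = (Fintype.card G : K) • σ s w := by
  have hcard : Fintype.card (G →* Kˣ) = Fintype.card G := by
    simpa only [Nat.card_eq_fintype_card] using
      CommGroup.card_monoidHom_of_hasEnoughRootsOfUnity G K
  simp only [charSum, Finset.smul_sum, smul_smul]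
  rw [Finset.sum_comm]
  simp only [← Finset.sum_smul]
  rw [Finset.sum_eq_single s]
  · simp [hcard]
  · intro t _ hts
    have h := sum_monoidHom_apply_eq_zero (K := K) (mt inv_mul_eq_one.1 hts.symm)
    simp only [map_mul, map_inv, Units.val_mul] at h
    rw [h, zero_smul]
  · simp

variable [NeZero (Fintype.card G : K)]

theorem span_charSum_eq_span_orbit (σ : Representation K G W) (w : W) :
    Submodule.span K (Set.range fun χ : {χ : G →* Kˣ | σ.charSum w χ ≠ 0} => σ.charSum w χ) =
      Submodule.span K (Set.range fun t : G => σ t w) := by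
  have : Fintype (G →* Kˣ) := Fintype.ofFinite _
  apply le_antisymm <;> rw [Submodule.span_le] <;> rintro _ ⟨x, rfl⟩
  · exact Submodule.sum_mem _ fun t _ =>
      Submodule.smul_mem _ _ (Submodule.subset_span ⟨t, rfl⟩)
  · refine (Submodule.smul_mem_iff _ (NeZero.ne (Fintype.card G : K))).1 ?_
    rw [← sum_inv_smul_charSum]
    refine Submodule.sum_mem _ fun χ _ => Submodule.smul_mem _ _ ?_
    by_cases hχ : σ.charSum w χ = 0
    · rw [hχ]
      exact Submodule.zero_mem _
    · exact Submodule.subset_span ⟨⟨χ, hχ⟩, rfl⟩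

theorem finrank_span_orbit_eq_ncard (σ : Representation K G W) (w : W) :
    Module.finrank K (Submodule.span K (Set.range fun t : G => σ t w)) =
      {χ : G →* Kˣ | σ.charSum w χ ≠ 0}.ncard := by
  have := Fintype.ofFinite {χ : G →* Kˣ | σ.charSum w χ ≠ 0}
  rw [← span_charSum_eq_span_orbit, finrank_span_eq_card (σ.linearIndependent_charSum w),
    ← Nat.card_eq_fintype_card, Nat.card_coe_set_eq]

end Representation

theorem Submodule.finrank_baseChange_of_field {F : Type*} (L : Type*) {V : Type*} [Field F]
    [Field L] [Algebra F L] [AddCommGroup V] [Module F V] (p : Submodule F V) :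
    Module.finrank L (p.baseChange L) = Module.finrank F p := by
  rw [← (Submodule.toBaseChange.toLinearEquiv L p).finrank_eq, Module.finrank_baseChange]

/-- Let `G` be a finite abelian group, `V` a finite-dimensional `ℚ`-vector space,
`ρ : G → GL(V)` a `ℚ`-linear representation and `v ∈ V`.  The `ℚ`-dimension of the
span of the orbit `{ρ(t) v : t ∈ G}` equals the number of characters `χ : G → ℂˣ`
such that `∑ t, χ t • (ρ t v ⊗ 1) ≠ 0` in the complexification `ℂ ⊗[ℚ] V`. -/
theorem finrank_span_orbit_eq_ncard_characters_rat
    (G : Type) [CommGroup G] [Fintype G]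
    (V : Type) [AddCommGroup V] [Module ℚ V] [FiniteDimensional ℚ V]
    (ρ : Representation ℚ G V) (v : V) :
    Module.finrank ℚ (Submodule.span ℚ (Set.range fun t : G => ρ t v))
      = {χ : G →* ℂˣ |
          ∑ t : G, (χ t : ℂ) • ((1 : ℂ) ⊗ₜ[ℚ] (ρ t v)) ≠ (0 : ℂ ⊗[ℚ] V)}.ncard := by
  let σ : Representation ℂ G (ℂ ⊗[ℚ] V) :=
    (Module.End.baseChangeHom ℚ ℂ V : Module.End ℚ V →* Module.End ℂ (ℂ ⊗[ℚ] V)).comp ρ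
  have h := σ.finrank_span_orbit_eq_ncard (1 ⊗ₜ v)
  rw [← Submodule.finrank_baseChange_of_field ℂ, Submodule.baseChange_span, ← Set.range_comp]
  exact h
end

section
/- Fix an algebraic closure ℚ̄ of ℚ and a totally real number field F ⊆ ℚ̄. Then for all but finitely many totally imaginary quadratic extensions K of F inside ℚ̄, the unit group 𝒪_K^× of the ring of integers of K is equal to the image of the unit group 𝒪_F^× under the inclusion 𝒪_F ⊆ 𝒪_K. -/
open NumberField Module

/-- A field is totally real if all of its complex embeddings are real. -/
def IsTotallyRealField (K : Type*) [Field K] : Prop :=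
  ∀ φ : K →+* ℂ, ComplexEmbedding.IsReal φ

/-- A field is totally imaginary if none of its complex embeddings is real. -/
def IsTotallyImaginaryField (K : Type*) [Field K] : Prop :=
  ∀ φ : K →+* ℂ, ¬ ComplexEmbedding.IsReal φ

/-- The coefficients of the minimal polynomial over `ℤ` of an algebraic integer whose conjugates
have norm at most `B` are bounded in terms of `B` and the degree of the field. -/
lemma NumberField.natDegree_minpoly_int_le_and_coeff_mem_Icc {K : Type*} [Field K] [NumberField K]
    {y : K} (hy : IsIntegral ℤ y) {B : ℝ} (hB : ∀ φ : K →+* ℂ, ‖φ y‖ ≤ B) {n : ℕ}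
    (hn : finrank ℚ K = n) :
    (minpoly ℤ y).natDegree ≤ n ∧ ∀ i, (minpoly ℤ y).coeff i ∈
      Set.Icc (-⌈max B 1 ^ n * n.choose (n / 2)⌉₊ : ℤ) ⌈max B 1 ^ n * n.choose (n / 2)⌉₊ := by
  have hmin := minpoly.isIntegrallyClosed_eq_field_fractions' ℚ hy
  subst hn
  refine ⟨?_, fun i ↦ ?_⟩
  · rw [← (minpoly.monic hy).natDegree_map (algebraMap ℤ ℚ), ← hmin]
    exact minpoly.natDegree_le y
  · rw [Set.mem_Icc, ← abs_le, ← @Int.cast_le ℝ, Int.cast_natCast]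
    refine (Eq.trans_le ?_ <| Embeddings.coeff_bdd_of_norm_le hB i).trans (Nat.le_ceil _)
    rw [hmin, Polynomial.coeff_map, eq_intCast, Int.norm_cast_rat, Int.norm_eq_abs, Int.cast_abs]

/-- The elements of `A` that lie in some subfield of degree `n` over `ℚ`, are integral over `ℤ` and
have all their conjugates of norm at most `B` form a finite set. -/
lemma finite_isIntegral_norm_le_of_finrank_eq (A : Type*) [Field A] [Algebra ℚ A] (n : ℕ) (B : ℝ) :
    {x : A | ∃ K : IntermediateField ℚ A, ∃ (_ : NumberField K) (y : K), finrank ℚ K = n ∧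
      IsIntegral ℤ y ∧ (∀ φ : K →+* ℂ, ‖φ y‖ ≤ B) ∧ (y : A) = x}.Finite := by
  classical
  have : CharZero A := algebraRat.charZero A
  refine (Polynomial.bUnion_roots_finite (algebraMap ℤ A) n (Set.finite_Icc
    (-⌈max B 1 ^ n * n.choose (n / 2)⌉₊ : ℤ) ⌈max B 1 ^ n * n.choose (n / 2)⌉₊)).subset ?_
  rintro _ ⟨K, _, y, hn, hy, hB, rfl⟩
  simp_rw [Set.mem_iUnion]
  refine ⟨minpoly ℤ y, natDegree_minpoly_int_le_and_coeff_mem_Icc hy hB ?_,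
    Polynomial.mem_rootSet.2 ⟨minpoly.ne_zero hy, ?_⟩⟩
  · rw [← hn]
    congr!
    subsingleton
  · have h := Polynomial.aeval_algebraMap_apply A y (minpoly ℤ y)
    rwa [minpoly.aeval, map_zero] at h

/-- In an extension of degree two, any element outside the base field is a generator. -/
lemma IntermediateField.sup_adjoin_simple_eq_of_finrank_eq_two_mul {k A : Type*} [Field k] [Field A]
    [Algebra k A] {F K : IntermediateField k A} [FiniteDimensional k F] (hle : F ≤ K)
    (hfin : finrank k K = 2 * finrank k F) {s : A} (hsK : s ∈ K) (hsF : s ∉ F) :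
    F ⊔ IntermediateField.adjoin k {s} = K := by
  have hF : 0 < finrank k F := finrank_pos
  have : FiniteDimensional k K := FiniteDimensional.of_finrank_pos (by lia)
  have hLK : F ⊔ IntermediateField.adjoin k {s} ≤ K :=
    sup_le hle (IntermediateField.adjoin_simple_le_iff.2 hsK)
  have : FiniteDimensional k ↥(F ⊔ IntermediateField.adjoin k {s}) :=
    .of_injective (IntermediateField.inclusion hLK).toLinearMap
      (IntermediateField.inclusion_injective hLK)
  have hFL : F ≤ F ⊔ IntermediateField.adjoin k {s} := le_sup_left
  refine IntermediateField.eq_of_le_of_finrank_le hLK ?_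
  obtain ⟨m, hm⟩ := IntermediateField.finrank_dvd_of_le_right hFL
  have hne : finrank k F ≠ finrank k ↥(F ⊔ IntermediateField.adjoin k {s}) := fun h ↦
    hsF <| (IntermediateField.eq_of_le_of_finrank_eq hFL h) ▸
      le_sup_right (a := F) (IntermediateField.mem_adjoin_simple_self k s)
  have hpos : 0 < finrank k ↥(F ⊔ IntermediateField.adjoin k {s}) := finrank_pos
  have hm2 : 2 ≤ m := by
    by_contra! h
    interval_cases m <;> simp_all
  rw [hfin, hm, mul_comm]
  exact Nat.mul_le_mul_left _ hm2

/-- In an extension of number fields, a unit of the top ring of integers lying in the bottom field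
is the image of a unit. -/
lemma NumberField.exists_unit_algebraMap_eq {F K : Type*} [Field F] [Field K] [Algebra F K]
    (u : (𝓞 K)ˣ) {x : F} (hx : algebraMap F K x = (u : 𝓞 K)) :
    ∃ v : (𝓞 F)ˣ, ((v : 𝓞 F) : F) = x := by
  have hint : ∀ (w : 𝓞 K) (y : F), algebraMap F K y = w → IsIntegral ℤ y := fun w y h ↦
    (isIntegral_algebraMap_iff (algebraMap F K).injective).1 (h ▸ w.isIntegral_coe)
  have hxinv : algebraMap F K x⁻¹ = ((u⁻¹ : (𝓞 K)ˣ) : 𝓞 K) := by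
    rw [map_inv₀, hx]
    refine inv_eq_of_mul_eq_one_right ?_
    rw [← map_mul, Units.mul_inv, map_one]
  have hx0 : x ≠ 0 := by
    rintro rfl
    rw [map_zero] at hx
    exact u.ne_zero (RingOfIntegers.ext (by simpa using hx.symm))
  exact ⟨⟨⟨x, hint _ _ hx⟩, ⟨x⁻¹, hint _ _ hxinv⟩, RingOfIntegers.ext (mul_inv_cancel₀ hx0),
    RingOfIntegers.ext (inv_mul_cancel₀ hx0)⟩, rfl⟩

/-- If a CM extension `K/F` has a unit outside `F`, then there is an element of `K` outside `F`
that is either integral with all conjugates of norm at most one, or a unit whose square is a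
unit of `F`. -/
lemma NumberField.exists_notMem_range_norm_le_one_or_sq_eq {F K : Type*} [Field F]
    [IsTotallyReal F] [Field K] [CharZero K] [Algebra.IsIntegral ℚ K] [IsTotallyComplex K]
    [Algebra F K] [Algebra.IsQuadraticExtension F K] (u : (𝓞 K)ˣ)
    (hu : ((u : 𝓞 K) : K) ∉ Set.range (algebraMap F K)) :
    ∃ y : K, y ∉ Set.range (algebraMap F K) ∧
      ((IsIntegral ℤ y ∧ ∀ φ : K →+* ℂ, ‖φ y‖ ≤ 1) ∨
        ∃ v : (𝓞 F)ˣ, y ^ 2 = algebraMap F K (v : 𝓞 F)) := by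
  have := IsCMField.ofCMExtension F K
  have hfix (x : K) : IsCMField.complexConj K x = x ↔ x ∈ Set.range (algebraMap F K) := by
    rw [IsCMField.complexConj_eq_self_iff]
    constructor
    · intro h
      exact ⟨_, CMExtension.algebraMap_equivMaximalRealSubfield_symm_apply F K ⟨x, h⟩⟩
    · rintro ⟨x, rfl⟩
      rw [← CMExtension.equivMaximalRealSubfield_apply]
      exact SetLike.coe_mem _
  set c := IsCMField.complexConj K with hc
  have hu0 : ((u : 𝓞 K) : K) ≠ 0 := RingOfIntegers.coe_ne_zero_iff.2 u.ne_zero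
  have hcu0 : c (u : 𝓞 K) ≠ 0 := (map_ne_zero c).2 hu0
  by_cases hsq : c ((u : 𝓞 K) : K) ^ 2 = ((u : 𝓞 K) : K) ^ 2
  · obtain ⟨x, hx⟩ := (hfix (((u : 𝓞 K) : K) ^ 2)).1 (by rw [map_pow, hsq])
    obtain ⟨v, rfl⟩ := exists_unit_algebraMap_eq (u ^ 2) (x := x) (by simpa using hx)
    exact ⟨_, hu, .inr ⟨v, hx.symm⟩⟩
  · refine ⟨(u : 𝓞 K) * (c (u : 𝓞 K))⁻¹, fun h ↦ hsq ?_, .inl ⟨?_, fun φ ↦ ?_⟩⟩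
    · rw [← hfix, map_mul, map_inv₀, hc, IsCMField.complexConj_apply_apply, ← hc] at h
      field_simp at h
      exact h
    · refine (u : 𝓞 K).isIntegral_coe.mul ?_
      rw [← map_inv₀]
      refine IsIntegral.map (c.toAlgHom.restrictScalars ℤ) ?_
      convert ((u⁻¹ : (𝓞 K)ˣ) : 𝓞 K).isIntegral_coe
      refine inv_eq_of_mul_eq_one_right ?_
      rw [← map_mul, Units.mul_inv, map_one]
    · rw [map_mul, map_inv₀, hc, IsCMField.complexEmbedding_complexConj, norm_mul, norm_inv,
        Complex.norm_conj]
      exact mul_inv_le_one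

/-- Finitely many square roots of units represent the square roots of all units, up to units. -/
lemma NumberField.exists_finite_sq_eq_unit (F A : Type*) [Field F] [NumberField F] [Field A]
    [Algebra F A] : ∃ S : Set A, S.Finite ∧ ∀ (y : A) (v : (𝓞 F)ˣ),
      y ^ 2 = algebraMap F A (v : 𝓞 F) → ∃ w : (𝓞 F)ˣ, y * algebraMap F A (w : 𝓞 F) ∈ S := by
  have : Group.FG (𝓞 F)ˣ := Group.fg_iff_monoid_fg.2 inferInstance
  let H := (powMonoidHom (α := (𝓞 F)ˣ) 2).range
  have : H.FiniteIndex := Subgroup.finiteIndex_range_powMonoidHom_of_fg _ two_ne_zero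
  refine ⟨⋃ q : (𝓞 F)ˣ ⧸ H, {s | s ^ 2 = algebraMap F A (q.out : 𝓞 F)},
    Set.finite_iUnion fun q ↦ ?_, fun y v hy ↦ ?_⟩
  · refine (Polynomial.nthRoots 2 (algebraMap F A (q.out : 𝓞 F))).finite_toSet.subset ?_
    intro s hs
    exact (Polynomial.mem_nthRoots two_pos).2 hs
  · obtain ⟨⟨_, w, rfl⟩, hw⟩ := QuotientGroup.mk_out_eq_mul H v
    refine ⟨w, Set.mem_iUnion.2 ⟨(v : (𝓞 F)ˣ ⧸ H), ?_⟩⟩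
    rw [Set.mem_ofPred_eq, hw, mul_pow, hy]
    simp

/-- Let `F` be a totally real number field inside a fixed algebraic closure `ℚ̄` of `ℚ`.
For all but finitely many totally imaginary quadratic extensions `K/F` inside `ℚ̄`,
the unit group `𝒪_K^×` equals the image of `𝒪_F^×` under the inclusion
`𝒪_F ⊆ 𝒪_K`. -/
theorem finite_CM_ext_units_ne_image_units
    (F : IntermediateField ℚ (AlgebraicClosure ℚ)) [NumberField ↥F]
    (hFreal : IsTotallyRealField ↥F) :
    {K : IntermediateField ℚ (AlgebraicClosure ℚ) |
      ∃ hle : F ≤ K, IsTotallyImaginaryField ↥K ∧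
        finrank ℚ ↥K = 2 * finrank ℚ ↥F ∧
        ¬ ({x : 𝓞 ↥K | IsUnit x} =
            Set.range fun v : (𝓞 ↥F)ˣ =>
              RingOfIntegers.mapRingHom (IntermediateField.inclusion hle)
                (v : 𝓞 ↥F))}.Finite := by
  obtain ⟨S, hS, hSsq⟩ := exists_finite_sq_eq_unit F (AlgebraicClosure ℚ)
  refine (((finite_isIntegral_norm_le_of_finrank_eq (AlgebraicClosure ℚ) (2 * finrank ℚ F) 1).union
    hS).image fun s ↦ F ⊔ IntermediateField.adjoin ℚ {s}).subset ?_
  rintro K ⟨hle, hK, hfin, hne⟩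
  suffices ∃ s ∈ K, s ∉ F ∧ s ∈ {x : AlgebraicClosure ℚ | ∃ K : IntermediateField ℚ (AlgebraicClosure ℚ),
      ∃ (_ : NumberField K) (y : K), finrank ℚ K = 2 * finrank ℚ F ∧
      IsIntegral ℤ y ∧ (∀ φ : K →+* ℂ, ‖φ y‖ ≤ 1) ∧ (y : AlgebraicClosure ℚ) = x} ∪ S by
    obtain ⟨s, hsK, hsF, hs⟩ := this
    exact ⟨s, hs, IntermediateField.sup_adjoin_simple_eq_of_finrank_eq_two_mul hle hfin hsK hsF⟩
  have hF : 0 < finrank ℚ F := finrank_pos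
  have : FiniteDimensional ℚ K := FiniteDimensional.of_finrank_pos (by lia)
  have : NumberField K := ⟨⟩
  let : Algebra F K := (IntermediateField.inclusion hle).toRingHom.toAlgebra
  have hrange (y : K) : y ∈ Set.range (algebraMap F K) ↔ (y : AlgebraicClosure ℚ) ∈ F :=
    ⟨fun ⟨x, hx⟩ ↦ hx ▸ x.2, fun h ↦ ⟨⟨y, h⟩, rfl⟩⟩
  have : IsScalarTower ℚ F K := .of_algebraMap_eq fun _ ↦ rfl
  have : Algebra.IsQuadraticExtension F K := ⟨by
    have := finrank_mul_finrank ℚ F K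
    rw [hfin, mul_comm] at this
    exact Nat.eq_of_mul_eq_mul_right hF this⟩
  have : IsTotallyReal F := ⟨fun v ↦ InfinitePlace.isReal_iff.2 (hFreal _)⟩
  have : IsTotallyComplex K := ⟨fun v ↦ InfinitePlace.isComplex_iff.2 (hK _)⟩
  obtain ⟨u, hu⟩ : ∃ u : (𝓞 K)ˣ, ((u : 𝓞 K) : K) ∉ Set.range (algebraMap F K) := by
    by_contra! h
    refine hne (Set.Subset.antisymm ?_ ?_)
    · rintro _ ⟨u, rfl⟩
      obtain ⟨x, hx⟩ := h u
      obtain ⟨v, rfl⟩ := exists_unit_algebraMap_eq u hx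
      exact ⟨v, RingOfIntegers.ext hx⟩
    · rintro _ ⟨v, rfl⟩
      exact v.isUnit.map _
  obtain ⟨y, hy, ⟨hint, hnorm⟩ | ⟨v, hv⟩⟩ := exists_notMem_range_norm_le_one_or_sq_eq u hu
  · exact ⟨y, y.2, fun h ↦ hy ((hrange y).2 h), .inl ⟨K, ‹_›, y, hfin, hint, hnorm, rfl⟩⟩
  · obtain ⟨w, hw⟩ := hSsq y v (congrArg Subtype.val hv)
    have hw0 : ((w : 𝓞 F) : F) ≠ 0 := RingOfIntegers.coe_ne_zero_iff.2 w.ne_zero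
    refine ⟨_, K.mul_mem y.2 (hle ((w : 𝓞 F) : F).2), fun h ↦ hy ((hrange y).2 ?_), .inr hw⟩
    have := F.div_mem h ((w : 𝓞 F) : F).2
    rwa [mul_div_cancel_right₀] at this
    exact fun h ↦ hw0 (Subtype.ext h)
end
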